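/- arXiv:2411.08938 — 6 statements merged into one kernel-verified Lean document; each statement's English description precedes it below -/
import Mathlib

section
/- (Discriminant identity and positivity, three-layer case.) For all real numbers r₁, r₂, r₃ one has the algebraic identity Ξ₃² − 4 r₁ r₂ r₃² (r₂ − r₃)(r₁³ − r₂³) = ( r₂(r₁³ − r₂³) − r₁ r₃²(r₂ − r₃) + r₂ r₃³ )² + 4 r₁ r₂ r₃⁵ (r₂ − r₃), where Ξ₃ = r₂(r₁³ − r₂³ + r₃³) + r₁ r₃²(r₂ − r₃). Consequently, if r₁ > r₂ > r₃ > 0 then Ξ₃² − 4 r₁ r₂ r₃² (r₂ − r₃)(r₁³ − r₂³) > 0. -/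
/-- Discriminant identity and positivity for the three-layer case:
with `Ξ₃ = r₂(r₁³ − r₂³ + r₃³) + r₁r₃²(r₂ − r₃)`, one has
`Ξ₃² − 4r₁r₂r₃²(r₂ − r₃)(r₁³ − r₂³)
  = (r₂(r₁³ − r₂³) − r₁r₃²(r₂ − r₃) + r₂r₃³)² + 4r₁r₂r₃⁵(r₂ − r₃)` for all reals,
and this quantity is strictly positive whenever `r₁ > r₂ > r₃ > 0`. -/
theorem three_layer_discriminant (r1 r2 r3 : ℝ) :
    ((r2 * (r1 ^ 3 - r2 ^ 3 + r3 ^ 3) + r1 * r3 ^ 2 * (r2 - r3)) ^ 2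
        - 4 * r1 * r2 * r3 ^ 2 * (r2 - r3) * (r1 ^ 3 - r2 ^ 3)
      = (r2 * (r1 ^ 3 - r2 ^ 3) - r1 * r3 ^ 2 * (r2 - r3) + r2 * r3 ^ 3) ^ 2
        + 4 * r1 * r2 * r3 ^ 5 * (r2 - r3)) ∧
    (0 < r3 → r3 < r2 → r2 < r1 →
      0 < (r2 * (r1 ^ 3 - r2 ^ 3 + r3 ^ 3) + r1 * r3 ^ 2 * (r2 - r3)) ^ 2
        - 4 * r1 * r2 * r3 ^ 2 * (r2 - r3) * (r1 ^ 3 - r2 ^ 3)) := by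
  have discrim_eq : (r2 * (r1 ^ 3 - r2 ^ 3 + r3 ^ 3) + r1 * r3 ^ 2 * (r2 - r3)) ^ 2
        - 4 * r1 * r2 * r3 ^ 2 * (r2 - r3) * (r1 ^ 3 - r2 ^ 3)
      = (r2 * (r1 ^ 3 - r2 ^ 3) - r1 * r3 ^ 2 * (r2 - r3) + r2 * r3 ^ 3) ^ 2
        + 4 * r1 * r2 * r3 ^ 5 * (r2 - r3) := by ring
  refine ⟨discrim_eq, fun h3 h32 h21 => ?_⟩
  rw [discrim_eq]
  have h2 : 0 < r2 := h3.trans h32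
  have h1 : 0 < r1 := h2.trans h21
  have hd : 0 < r2 - r3 := sub_pos.mpr h32
  positivity
end

section
/- (Discriminant identity and positivity, four-layer case.) For all real numbers r₁, r₂, r₃, r₄ one has the algebraic identity Ξ₄² − 4 r₁ r₂ r₃ (r₁³ − r₂³)(r₃³ − r₄³)(r₂ − r₃) = ( r₂ r₃ (r₁³ − r₂³ + r₃³ − r₄³) − r₁ (r₂ − r₃)(r₃³ − r₄³) )² + 4 r₁ r₂ r₃ (r₂ − r₃)(r₃³ − r₄³)², where Ξ₄ = r₂ r₃ (r₁³ − r₂³ + r₃³ − r₄³) + r₁ (r₂ − r₃)(r₃³ − r₄³). Consequently, if r₁ > r₂ > r₃ > r₄ > 0 then Ξ₄² − 4 r₁ r₂ r₃ (r₁³ − r₂³)(r₃³ − r₄³)(r₂ − r₃) > 0. -/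
/-- Discriminant identity and positivity for the four-layer case:
with `Ξ₄ = r₂r₃(r₁³ − r₂³ + r₃³ − r₄³) + r₁(r₂ − r₃)(r₃³ − r₄³)`, one has
`Ξ₄² − 4r₁r₂r₃(r₁³ − r₂³)(r₃³ − r₄³)(r₂ − r₃)
  = (r₂r₃(r₁³ − r₂³ + r₃³ − r₄³) − r₁(r₂ − r₃)(r₃³ − r₄³))²
    + 4r₁r₂r₃(r₂ − r₃)(r₃³ − r₄³)²` for all reals, and this quantity is strictly
positive whenever `r₁ > r₂ > r₃ > r₄ > 0`. -/
theorem four_layer_discriminant (r1 r2 r3 r4 : ℝ) :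
    ((r2 * r3 * (r1 ^ 3 - r2 ^ 3 + r3 ^ 3 - r4 ^ 3)
          + r1 * (r2 - r3) * (r3 ^ 3 - r4 ^ 3)) ^ 2
        - 4 * r1 * r2 * r3 * (r1 ^ 3 - r2 ^ 3) * (r3 ^ 3 - r4 ^ 3) * (r2 - r3)
      = (r2 * r3 * (r1 ^ 3 - r2 ^ 3 + r3 ^ 3 - r4 ^ 3)
          - r1 * (r2 - r3) * (r3 ^ 3 - r4 ^ 3)) ^ 2
        + 4 * r1 * r2 * r3 * (r2 - r3) * (r3 ^ 3 - r4 ^ 3) ^ 2) ∧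
    (0 < r4 → r4 < r3 → r3 < r2 → r2 < r1 →
      0 < (r2 * r3 * (r1 ^ 3 - r2 ^ 3 + r3 ^ 3 - r4 ^ 3)
            + r1 * (r2 - r3) * (r3 ^ 3 - r4 ^ 3)) ^ 2
          - 4 * r1 * r2 * r3 * (r1 ^ 3 - r2 ^ 3) * (r3 ^ 3 - r4 ^ 3) * (r2 - r3)) := by
  refine ⟨by ring, fun h4 h43 h32 h21 => ?_⟩
  have h3 : 0 < r3 := h4.trans h43
  have h2 : 0 < r2 := h3.trans h32
  have h1 : 0 < r1 := h2.trans h21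
  have hr : 0 < r2 - r3 := sub_pos.mpr h32
  have hc : 0 < r3 ^ 3 - r4 ^ 3 :=
    sub_pos.mpr (pow_lt_pow_left₀ h43 h4.le three_ne_zero)
  have hpos : 0 < (r2 * r3 * (r1 ^ 3 - r2 ^ 3 + r3 ^ 3 - r4 ^ 3)
          - r1 * (r2 - r3) * (r3 ^ 3 - r4 ^ 3)) ^ 2
        + 4 * r1 * r2 * r3 * (r2 - r3) * (r3 ^ 3 - r4 ^ 3) ^ 2 :=
    add_pos_of_nonneg_of_pos (sq_nonneg _) (by positivity)
  convert hpos using 1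
  ring
end

section
/- (Positivity of both leading-order squared resonant frequencies, three-layer case.) Let r₁ > r₂ > r₃ > 0, set Ξ₃ = r₂(r₁³ − r₂³ + r₃³) + r₁ r₃²(r₂ − r₃) and D₃ = Ξ₃² − 4 r₁ r₂ r₃² (r₂ − r₃)(r₁³ − r₂³). Then 0 < D₃ and √D₃ < Ξ₃; consequently both real numbers x₋ = 3(Ξ₃ − √D₃)/(2 (r₂ − r₃)(r₁³ − r₂³) r₃²) and x₊ = 3(Ξ₃ + √D₃)/(2 (r₂ − r₃)(r₁³ − r₂³) r₃²) are strictly positive, and x₋ < x₊. -/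
/-- Positivity of both leading-order squared resonant frequencies in the
three-layer case: with `Ξ₃` and `D₃` as stated, `0 < D₃`, `√D₃ < Ξ₃`, and both roots
`x₋ = 3(Ξ₃ − √D₃)/(2(r₂ − r₃)(r₁³ − r₂³)r₃²)` and
`x₊ = 3(Ξ₃ + √D₃)/(2(r₂ − r₃)(r₁³ − r₂³)r₃²)` are strictly positive with `x₋ < x₊`. -/
theorem three_layer_squared_frequencies_pos (r1 r2 r3 : ℝ)
    (h21 : r2 < r1) (h32 : r3 < r2) (hr3 : 0 < r3)
    (Ξ D xm xp : ℝ)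
    (hΞ : Ξ = r2 * (r1 ^ 3 - r2 ^ 3 + r3 ^ 3) + r1 * r3 ^ 2 * (r2 - r3))
    (hD : D = Ξ ^ 2 - 4 * r1 * r2 * r3 ^ 2 * (r2 - r3) * (r1 ^ 3 - r2 ^ 3))
    (hxm : xm = 3 * (Ξ - Real.sqrt D) / (2 * (r2 - r3) * (r1 ^ 3 - r2 ^ 3) * r3 ^ 2))
    (hxp : xp = 3 * (Ξ + Real.sqrt D) / (2 * (r2 - r3) * (r1 ^ 3 - r2 ^ 3) * r3 ^ 2)) :
    0 < D ∧ Real.sqrt D < Ξ ∧ 0 < xm ∧ 0 < xp ∧ xm < xp := by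
  have hr2 : 0 < r2 := hr3.trans h32
  have hr1 : 0 < r1 := hr2.trans h21
  have hgap : 0 < r2 - r3 := sub_pos.2 h32
  have hcube : 0 < r1 ^ 3 - r2 ^ 3 := sub_pos.2 (by gcongr)
  have hA : 0 < r2 * (r1 ^ 3 - r2 ^ 3) := by positivity
  have hB : 0 < r1 * r3 ^ 2 * (r2 - r3) := by positivity
  have hC : 0 < r2 * r3 ^ 3 := by positivity
  have hΞ' : Ξ = r2 * (r1 ^ 3 - r2 ^ 3) + r1 * r3 ^ 2 * (r2 - r3) + r2 * r3 ^ 3 := by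
    rw [hΞ]; ring
  have hD' : D = Ξ ^ 2 - 4 * (r2 * (r1 ^ 3 - r2 ^ 3)) * (r1 * r3 ^ 2 * (r2 - r3)) := by
    rw [hD]; ring
  have hden : 0 < 2 * (r2 - r3) * (r1 ^ 3 - r2 ^ 3) * r3 ^ 2 := by positivity
  generalize r2 * (r1 ^ 3 - r2 ^ 3) = A at hA hΞ' hD'
  generalize r1 * r3 ^ 2 * (r2 - r3) = B at hB hΞ' hD'
  generalize r2 * r3 ^ 3 = C at hC hΞ'
  have hΞpos : 0 < Ξ := by rw [hΞ']; positivity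
  have hDpos : 0 < D := by
    have h : D = (A - B) ^ 2 + C * (2 * A + 2 * B + C) := by rw [hD', hΞ']; ring
    rw [h]; positivity
  have hsqrt : Real.sqrt D < Ξ := by
    rw [Real.sqrt_lt' hΞpos, hD']
    have : 0 < A * B := mul_pos hA hB
    linarith
  have hsqrt_pos : 0 < Real.sqrt D := Real.sqrt_pos.2 hDpos
  refine ⟨hDpos, hsqrt, ?_, ?_, ?_⟩
  · rw [hxm]
    exact div_pos (by linarith) hden
  · rw [hxp]
    exact div_pos (by linarith) hden
  · rw [hxm, hxp]
    exact div_lt_div_of_pos_right (by linarith) hden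
end

section
/- (Positivity of both leading-order squared resonant frequencies, four-layer case.) Let r₁ > r₂ > r₃ > r₄ > 0, set Ξ₄ = r₂ r₃ (r₁³ − r₂³ + r₃³ − r₄³) + r₁ (r₂ − r₃)(r₃³ − r₄³) and D₄ = Ξ₄² − 4 r₁ r₂ r₃ (r₁³ − r₂³)(r₃³ − r₄³)(r₂ − r₃). Then 0 < D₄ and √D₄ < Ξ₄; consequently both real numbers x₋ = (3Ξ₄ − 3√D₄)/(2 (r₁³ − r₂³)(r₃³ − r₄³)(r₂ − r₃)) and x₊ = (3Ξ₄ + 3√D₄)/(2 (r₁³ − r₂³)(r₃³ − r₄³)(r₂ − r₃)) are strictly positive, and x₋ < x₊. -/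
/-- Positivity of both leading-order squared resonant frequencies in the
four-layer case: with `Ξ₄` and `D₄` as stated, `0 < D₄`, `√D₄ < Ξ₄`, and both roots
`x₋ = (3Ξ₄ − 3√D₄)/(2(r₁³ − r₂³)(r₃³ − r₄³)(r₂ − r₃))` and
`x₊ = (3Ξ₄ + 3√D₄)/(2(r₁³ − r₂³)(r₃³ − r₄³)(r₂ − r₃))` are strictly positive with
`x₋ < x₊`. -/
theorem four_layer_squared_frequencies_pos (r1 r2 r3 r4 : ℝ)
    (h21 : r2 < r1) (h32 : r3 < r2) (h43 : r4 < r3) (hr4 : 0 < r4)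
    (Ξ D xm xp : ℝ)
    (hΞ : Ξ = r2 * r3 * (r1 ^ 3 - r2 ^ 3 + r3 ^ 3 - r4 ^ 3)
        + r1 * (r2 - r3) * (r3 ^ 3 - r4 ^ 3))
    (hD : D = Ξ ^ 2 - 4 * r1 * r2 * r3 * (r1 ^ 3 - r2 ^ 3) * (r3 ^ 3 - r4 ^ 3)
        * (r2 - r3))
    (hxm : xm = (3 * Ξ - 3 * Real.sqrt D)
        / (2 * (r1 ^ 3 - r2 ^ 3) * (r3 ^ 3 - r4 ^ 3) * (r2 - r3)))
    (hxp : xp = (3 * Ξ + 3 * Real.sqrt D)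
        / (2 * (r1 ^ 3 - r2 ^ 3) * (r3 ^ 3 - r4 ^ 3) * (r2 - r3))) :
    0 < D ∧ Real.sqrt D < Ξ ∧ 0 < xm ∧ 0 < xp ∧ xm < xp := by
  have hr3 : 0 < r3 := hr4.trans h43
  have hr2 : 0 < r2 := hr3.trans h32
  have hr1 : 0 < r1 := hr2.trans h21
  have hA : 0 < r1 ^ 3 - r2 ^ 3 := sub_pos.2 (by gcongr)
  have hB : 0 < r3 ^ 3 - r4 ^ 3 := sub_pos.2 (by gcongr)
  have hd : 0 < r2 - r3 := sub_pos.2 h32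
  rw [add_sub_assoc] at hΞ
  generalize r1 ^ 3 - r2 ^ 3 = A at *
  generalize r3 ^ 3 - r4 ^ 3 = B at *
  generalize r2 - r3 = d at *
  have hΞ_pos : 0 < Ξ := by rw [hΞ]; positivity
  have hD_pos : 0 < D := by
    have h : D = (r2 * r3 * A + r2 * r3 * B - r1 * d * B) ^ 2
        + 4 * (r2 * r3 * B) * (r1 * d * B) := by
      rw [hD, hΞ]; ring
    rw [h]; positivity
  have hsqrt_lt : Real.sqrt D < Ξ := by
    rw [Real.sqrt_lt' hΞ_pos, hD]
    exact sub_lt_self _ (by positivity)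
  have hsqrt_pos : 0 < Real.sqrt D := Real.sqrt_pos.2 hD_pos
  have hden : 0 < 2 * A * B * d := by positivity
  refine ⟨hD_pos, hsqrt_lt, ?_, ?_, ?_⟩
  · rw [hxm]; exact div_pos (by linarith) hden
  · rw [hxp]; exact div_pos (by linarith) hden
  · rw [hxm, hxp]; exact div_lt_div_of_pos_right (by linarith) hden
end

section
/- (Mode splitting / hybridization straddling, three-layer case.) Let r₁ > r₂ > r₃ > 0, set Ξ₃ = r₂(r₁³ − r₂³ + r₃³) + r₁ r₃²(r₂ − r₃), D₃ = Ξ₃² − 4 r₁ r₂ r₃² (r₂ − r₃)(r₁³ − r₂³), x₋ = 3(Ξ₃ − √D₃)/(2 (r₂ − r₃)(r₁³ − r₂³) r₃²) and x₊ = 3(Ξ₃ + √D₃)/(2 (r₂ − r₃)(r₁³ − r₂³) r₃²). Then x₋ < 3 r₁/(r₁³ − r₂³) < x₊ and x₋ < 3/r₃² < x₊; that is, the two hybridized leading-order squared resonant frequencies of the dual-resonator strictly straddle the leading-order squared resonant frequencies 3 r₁/(r₁³ − r₂³) of the isolated outer shell and 3/r₃² of the isolated inner ball. -/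
/-- If `a * y² - 3 * b * y + 9 * c < 0` with `0 < a`, then `3 * z / a = y` lies strictly between the
roots of `a * x² - 3 * b * x + 9 * c`; the hypothesis is expressed through `z = a * y / 3`. -/
theorem div_mem_Ioo_roots {a b c z : ℝ} (ha : 0 < a) (hz : z * (z - b) + a * c < 0) :
    3 * (b - √(b ^ 2 - 4 * (a * c))) / (2 * a) < 3 * z / a ∧
      3 * z / a < 3 * (b + √(b ^ 2 - 4 * (a * c))) / (2 * a) := by
  have h : |2 * z - b| < √(b ^ 2 - 4 * (a * c)) := by
    apply Real.lt_sqrt_of_sq_lt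
    rw [sq_abs]
    linarith
  obtain ⟨h₁, h₂⟩ := abs_lt.mp h
  constructor <;> rw [div_lt_div_iff₀ (by positivity) (by positivity)] <;> nlinarith


/-- Mode splitting / hybridization straddling, three-layer case:
the two hybridized leading-order squared resonant frequencies `x₋ < x₊` of the
dual-resonator strictly straddle the leading-order squared resonant frequencies
`3r₁/(r₁³ − r₂³)` of the isolated outer shell and `3/r₃²` of the isolated inner ball. -/
theorem three_layer_mode_splitting (r1 r2 r3 : ℝ)
    (h21 : r2 < r1) (h32 : r3 < r2) (hr3 : 0 < r3)
    (Ξ D xm xp : ℝ)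
    (hΞ : Ξ = r2 * (r1 ^ 3 - r2 ^ 3 + r3 ^ 3) + r1 * r3 ^ 2 * (r2 - r3))
    (hD : D = Ξ ^ 2 - 4 * r1 * r2 * r3 ^ 2 * (r2 - r3) * (r1 ^ 3 - r2 ^ 3))
    (hxm : xm = 3 * (Ξ - Real.sqrt D) / (2 * (r2 - r3) * (r1 ^ 3 - r2 ^ 3) * r3 ^ 2))
    (hxp : xp = 3 * (Ξ + Real.sqrt D) / (2 * (r2 - r3) * (r1 ^ 3 - r2 ^ 3) * r3 ^ 2)) :
    (xm < 3 * r1 / (r1 ^ 3 - r2 ^ 3) ∧ 3 * r1 / (r1 ^ 3 - r2 ^ 3) < xp) ∧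
    (xm < 3 / r3 ^ 2 ∧ 3 / r3 ^ 2 < xp) := by
  have hp : 0 < r2 - r3 := sub_pos.mpr h32
  have hr2 : 0 < r2 := hr3.trans h32
  have hr1 : 0 < r1 := hr2.trans h21
  have hs : 0 < r1 ^ 3 - r2 ^ 3 := sub_pos.mpr (by gcongr)
  have hcube : r3 ^ 2 * (r1 - r2) < r1 ^ 3 - r2 ^ 3 := by
    have hsq : r3 ^ 2 < r1 ^ 2 + r1 * r2 + r2 ^ 2 := by
      have : r3 ^ 2 < r2 ^ 2 := by gcongr
      have : 0 < r1 ^ 2 + r1 * r2 := by positivity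
      linarith
    linarith [mul_lt_mul_of_pos_right hsq (sub_pos.mpr h21)]
  have ha : 0 < (r2 - r3) * (r1 ^ 3 - r2 ^ 3) * r3 ^ 2 := by positivity
  have hD' : D = Ξ ^ 2 - 4 * ((r2 - r3) * (r1 ^ 3 - r2 ^ 3) * r3 ^ 2 * (r1 * r2)) := by
    rw [hD]; ring
  have hden : 2 * (r2 - r3) * (r1 ^ 3 - r2 ^ 3) * r3 ^ 2 =
      2 * ((r2 - r3) * (r1 ^ 3 - r2 ^ 3) * r3 ^ 2) := by ring
  have hshell : 3 * r1 / (r1 ^ 3 - r2 ^ 3) =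
      3 * (r1 * (r2 - r3) * r3 ^ 2) / ((r2 - r3) * (r1 ^ 3 - r2 ^ 3) * r3 ^ 2) := by
    field_simp
  have hball : 3 / r3 ^ 2 =
      3 * ((r2 - r3) * (r1 ^ 3 - r2 ^ 3)) / ((r2 - r3) * (r1 ^ 3 - r2 ^ 3) * r3 ^ 2) := by
    field_simp
  rw [hxm, hxp, hden, hD', hshell, hball]
  constructor
  · apply div_mem_Ioo_roots ha
    have : 0 < r1 * (r2 - r3) * r3 ^ 2 * (r2 * r3 ^ 3) := by positivity
    rw [hΞ]
    linarith
  · apply div_mem_Ioo_roots ha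
    have : 0 < (r2 - r3) * (r1 ^ 3 - r2 ^ 3) * r3 * (r1 ^ 3 - r2 ^ 3 - r3 ^ 2 * (r1 - r2)) :=
      mul_pos (by positivity) (sub_pos.mpr hcube)
    rw [hΞ]
    linarith
end

section
/- (Mode splitting / hybridization straddling, four-layer case.) Let r₁ > r₂ > r₃ > r₄ > 0, set Ξ₄ = r₂ r₃ (r₁³ − r₂³ + r₃³ − r₄³) + r₁ (r₂ − r₃)(r₃³ − r₄³), D₄ = Ξ₄² − 4 r₁ r₂ r₃ (r₁³ − r₂³)(r₃³ − r₄³)(r₂ − r₃), x₋ = (3Ξ₄ − 3√D₄)/(2 (r₁³ − r₂³)(r₃³ − r₄³)(r₂ − r₃)) and x₊ = (3Ξ₄ + 3√D₄)/(2 (r₁³ − r₂³)(r₃³ − r₄³)(r₂ − r₃)). Then x₋ < 3 r₁/(r₁³ − r₂³) < x₊ and x₋ < 3 r₃/(r₃³ − r₄³) < x₊. In particular, if r₁/(r₁³ − r₂³) ≤ r₃/(r₃³ − r₄³) then x₋ < 3 r₁/(r₁³ − r₂³) ≤ 3 r₃/(r₃³ − r₄³) < x₊, i.e., at leading order the two hybridized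 resonant frequencies of the dual-resonator strictly straddle the resonant frequencies of the isolated outer shell and the isolated inner shell. -/
/-- A point where an upward-opening quadratic is negative lies strictly between its two roots. -/
theorem strictly_between_roots_of_quadratic_neg {a b c y : ℝ} (ha : 0 < a)
    (h : a * y ^ 2 - b * y + c < 0) :
    (b - √(b ^ 2 - 4 * a * c)) / (2 * a) < y ∧ y < (b + √(b ^ 2 - 4 * a * c)) / (2 * a) := by
  have hsq : (2 * a * y - b) ^ 2 < b ^ 2 - 4 * a * c := by
    nlinarith [mul_pos_of_neg_of_neg h (neg_neg_of_pos ha)]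
  have habs := abs_lt.mp (Real.lt_sqrt_of_sq_lt ((sq_abs _).trans_lt hsq))
  rw [div_lt_iff₀ (by positivity), lt_div_iff₀ (by positivity)]
  constructor <;> linarith [habs.1, habs.2]

/-- Mode splitting / hybridization straddling, four-layer case:
the two hybridized leading-order squared resonant frequencies `x₋ < x₊` of the
dual-resonator strictly straddle the leading-order squared resonant frequencies
`3r₁/(r₁³ − r₂³)` of the isolated outer shell and `3r₃/(r₃³ − r₄³)` of the isolated
inner shell; in particular, if `r₁/(r₁³ − r₂³) ≤ r₃/(r₃³ − r₄³)` then
`x₋ < 3r₁/(r₁³ − r₂³) ≤ 3r₃/(r₃³ − r₄³) < x₊`. -/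
theorem four_layer_mode_splitting (r1 r2 r3 r4 : ℝ)
    (h21 : r2 < r1) (h32 : r3 < r2) (h43 : r4 < r3) (hr4 : 0 < r4)
    (Ξ D xm xp : ℝ)
    (hΞ : Ξ = r2 * r3 * (r1 ^ 3 - r2 ^ 3 + r3 ^ 3 - r4 ^ 3)
        + r1 * (r2 - r3) * (r3 ^ 3 - r4 ^ 3))
    (hD : D = Ξ ^ 2 - 4 * r1 * r2 * r3 * (r1 ^ 3 - r2 ^ 3) * (r3 ^ 3 - r4 ^ 3)
        * (r2 - r3))
    (hxm : xm = (3 * Ξ - 3 * Real.sqrt D)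
        / (2 * (r1 ^ 3 - r2 ^ 3) * (r3 ^ 3 - r4 ^ 3) * (r2 - r3)))
    (hxp : xp = (3 * Ξ + 3 * Real.sqrt D)
        / (2 * (r1 ^ 3 - r2 ^ 3) * (r3 ^ 3 - r4 ^ 3) * (r2 - r3))) :
    (xm < 3 * r1 / (r1 ^ 3 - r2 ^ 3) ∧ 3 * r1 / (r1 ^ 3 - r2 ^ 3) < xp) ∧
    (xm < 3 * r3 / (r3 ^ 3 - r4 ^ 3) ∧ 3 * r3 / (r3 ^ 3 - r4 ^ 3) < xp) ∧
    (r1 / (r1 ^ 3 - r2 ^ 3) ≤ r3 / (r3 ^ 3 - r4 ^ 3) →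
      xm < 3 * r1 / (r1 ^ 3 - r2 ^ 3) ∧
      3 * r1 / (r1 ^ 3 - r2 ^ 3) ≤ 3 * r3 / (r3 ^ 3 - r4 ^ 3) ∧
      3 * r3 / (r3 ^ 3 - r4 ^ 3) < xp) := by
  have hr3 : 0 < r3 := hr4.trans h43
  have hr2 : 0 < r2 := hr3.trans h32
  have hr1 : 0 < r1 := hr2.trans h21
  have hA : 0 < r1 ^ 3 - r2 ^ 3 := sub_pos.mpr (pow_lt_pow_left₀ h21 hr2.le three_ne_zero)
  have hB : 0 < r3 ^ 3 - r4 ^ 3 := sub_pos.mpr (pow_lt_pow_left₀ h43 hr4.le three_ne_zero)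
  have hd : 0 < r2 - r3 := sub_pos.mpr h32
  have hAB : (r3 ^ 3 - r4 ^ 3) * (r1 - r2) < (r1 ^ 3 - r2 ^ 3) * r3 := by
    have h3 : r3 ^ 2 < r1 ^ 2 + r1 * r2 + r2 ^ 2 := by nlinarith [mul_pos hr1 hr2]
    calc (r3 ^ 3 - r4 ^ 3) * (r1 - r2) < r3 ^ 3 * (r1 - r2) :=
          mul_lt_mul_of_pos_right (sub_lt_self _ (by positivity)) (sub_pos.mpr h21)
      _ = r3 ^ 2 * ((r1 - r2) * r3) := by ring
      _ < (r1 ^ 2 + r1 * r2 + r2 ^ 2) * ((r1 - r2) * r3) :=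
          mul_lt_mul_of_pos_right h3 (mul_pos (sub_pos.mpr h21) hr3)
      _ = (r1 ^ 3 - r2 ^ 3) * r3 := by ring
  rw [add_sub_assoc] at hΞ
  generalize r1 ^ 3 - r2 ^ 3 = A at *
  generalize r3 ^ 3 - r4 ^ 3 = B at *
  have hsqrt : 3 * √D = √((3 * Ξ) ^ 2 - 4 * (A * B * (r2 - r3)) * (9 * r1 * r2 * r3)) := by
    rw [show (3 * Ξ) ^ 2 - 4 * (A * B * (r2 - r3)) * (9 * r1 * r2 * r3) = 3 ^ 2 * D by
      rw [hD]; ring, Real.sqrt_mul (by norm_num), Real.sqrt_sq (by norm_num)]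
  have hden : 2 * A * B * (r2 - r3) = 2 * (A * B * (r2 - r3)) := by ring
  have straddle (y : ℝ)
      (hy : A * B * (r2 - r3) * y ^ 2 - 3 * Ξ * y + 9 * r1 * r2 * r3 < 0) :
      xm < y ∧ y < xp := by
    rw [hxm, hxp, hsqrt, hden]
    exact strictly_between_roots_of_quadratic_neg (by positivity) hy
  have outer := straddle (3 * r1 / A) (by
    rw [show A * B * (r2 - r3) * (3 * r1 / A) ^ 2 - 3 * Ξ * (3 * r1 / A) + 9 * r1 * r2 * r3
        = -(9 * r1 * r2 * r3 * B / A) by rw [hΞ]; field_simp; ring]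
    exact neg_neg_of_pos (by positivity))
  have inner := straddle (3 * r3 / B) (by
    rw [show A * B * (r2 - r3) * (3 * r3 / B) ^ 2 - 3 * Ξ * (3 * r3 / B) + 9 * r1 * r2 * r3
        = -(9 * r3 ^ 2 / B * (A * r3 - B * (r1 - r2))) by rw [hΞ]; field_simp; ring]
    exact neg_neg_of_pos (mul_pos (by positivity) (sub_pos.mpr hAB)))
  refine ⟨outer, inner, fun h => ⟨outer.1, ?_, inner.2⟩⟩
  rw [mul_div_assoc, mul_div_assoc]
  exact mul_le_mul_of_nonneg_left h (by norm_num)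
end
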